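/- For all positive integers k and p, the number of domino tilings of the region T(k,2k+2,p) is odd. -/

import Mathlib

/-- Two cells of `ℤ × ℤ` are adjacent if they differ by `(1,0)` or `(0,1)`. -/
def Adjacent (a b : ℤ × ℤ) : Prop :=
  (a.1 = b.1 ∧ (a.2 = b.2 + 1 ∨ b.2 = a.2 + 1)) ∨
  (a.2 = b.2 ∧ (a.1 = b.1 + 1 ∨ b.1 = a.1 + 1))

/-- `T` is a domino tiling of `R`: a partition of `R` into two-element sets of adjacent cells. -/
def IsDominoTiling (R : Set (ℤ × ℤ)) (T : Set (Set (ℤ × ℤ))) : Prop :=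
  (∀ d ∈ T, ∃ a b, Adjacent a b ∧ d = {a, b}) ∧
  T.PairwiseDisjoint id ∧
  ⋃₀ T = R

/-- The number of domino tilings of `R`. -/
noncomputable def numTilings (R : Set (ℤ × ℤ)) : ℕ :=
  Nat.card {T : Set (Set (ℤ × ℤ)) // IsDominoTiling R T}

/-- The region `T(i,j,p)`: rows `r = 0, …, i+p-2` from top to bottom of lengths
`j, j+2, …, j+2(p-2)` followed by `i` rows of length `j+2(p-1)`, centers aligned. -/
def Treg (i j p : ℕ) : Set (ℤ × ℤ) :=
  {q | 0 ≤ q.2 ∧ q.2 ≤ (i : ℤ) + p - 2 ∧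
    (p : ℤ) - 1 - min q.2 ((p : ℤ) - 1) ≤ q.1 ∧
    q.1 ≤ (p : ℤ) - 2 + j + min q.2 ((p : ℤ) - 1)}

section Helpers

lemma adj_symm {a b : ℤ × ℤ} (h : Adjacent a b) : Adjacent b a := by
  unfold Adjacent at *; omega

lemma adj_ne {a b : ℤ × ℤ} (h : Adjacent a b) : a ≠ b := by
  rintro rfl; unfold Adjacent at h; omega

lemma z2_self (a : ZMod 2) : a + a = 0 := CharTwo.add_self_eq_zero a

open Classical in
lemma det_parity {V : Type*} [Fintype V] [DecidableEq V] (adj : V → V → Prop)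
    (hs : ∀ a b, adj a b → adj b a) :
    (Matrix.of (fun a b : V => if adj a b then (1 : ZMod 2) else 0)).det =
      (Nat.card {σ : Equiv.Perm V // (∀ v, adj (σ v) v) ∧ σ⁻¹ = σ} : ZMod 2) := by
  rw [Matrix.det_apply]
  have h1 : ∀ σ : Equiv.Perm V, Equiv.Perm.sign σ •
      ∏ i, (Matrix.of (fun a b : V => if adj a b then (1 : ZMod 2) else 0)) (σ i) i
      = if ∀ v, adj (σ v) v then (1 : ZMod 2) else 0 := by
    intro σ
    have h2 : ∀ x : ZMod 2, Equiv.Perm.sign σ • x = x := by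
      intro x
      rcases Int.units_eq_one_or (Equiv.Perm.sign σ) with h | h
      · rw [h]; simp
      · rw [h]; simp [CharTwo.neg_eq]
    rw [h2]
    simp only [Matrix.of_apply]
    rw [Finset.prod_ite_zero]
    simp
  rw [Finset.sum_congr rfl (fun σ _ => h1 σ)]
  rw [← Finset.sum_filter_add_sum_filter_not Finset.univ (fun σ : Equiv.Perm V => σ⁻¹ = σ)]
  have h3 : (∑ σ ∈ Finset.univ.filter (fun σ : Equiv.Perm V => ¬ σ⁻¹ = σ),
      if ∀ v, adj (σ v) v then (1 : ZMod 2) else 0) = 0 := by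
    refine Finset.sum_involution (fun σ _ => σ⁻¹) ?_ ?_ ?_ ?_
    · intro σ _
      have : (∀ v, adj (σ⁻¹ v) v) ↔ ∀ v, adj (σ v) v := by
        constructor
        · intro h v
          have := h (σ v)
          simp at this
          exact hs _ _ this
        · intro h v
          have := h (σ⁻¹ v)
          simp at this
          exact hs _ _ this
      simp only [this]
      exact z2_self _
    · intro σ h _
      simpa using h
    · intro σ h
      simp only [Finset.mem_filter, Finset.mem_univ, true_and, inv_inv] at h ⊢
      exact fun h' => h h'.symm
    · intro σ _
      simp
  rw [h3, add_zero, ← Finset.sum_filter, Finset.filter_filter, Nat.card_eq_fintype_card,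
    Fintype.card_subtype]
  simp [and_comm]

lemma tiling_bij (R : Set (ℤ × ℤ)) :
    numTilings R = Nat.card {σ : Equiv.Perm R //
      (∀ v, Adjacent (σ v : ℤ × ℤ) (v : ℤ × ℤ)) ∧ σ⁻¹ = σ} := by
  unfold numTilings
  symm
  refine Nat.card_congr (Equiv.ofBijective
    (fun s => ⟨{d | ∃ v : R, d = {(v : ℤ × ℤ), (s.1 v : ℤ × ℤ)}}, ?_⟩) ⟨?_, ?_⟩)
  · obtain ⟨σ, h1, h2⟩ := s
    have hinv : ∀ v, σ (σ v) = v := by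
      intro v
      conv_lhs => rw [← h2]
      rw [h2]
      conv_lhs => arg 1; rw [← h2]
      simp
    refine ⟨?_, ?_, ?_⟩
    · rintro d ⟨v, rfl⟩
      exact ⟨_, _, adj_symm (h1 v), rfl⟩
    · rintro d ⟨v, rfl⟩ e ⟨w, rfl⟩ hne
      simp only [Function.onFun, id]
      rw [Set.disjoint_left]
      intro x hx hx'
      apply hne
      simp only [Set.mem_insert_iff, Set.mem_singleton_iff] at hx hx'
      have key : v = w ∨ v = σ w := by
        rcases hx with rfl | rfl <;> rcases hx' with h | h
        · exact Or.inl (Subtype.ext h)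
        · exact Or.inr (Subtype.ext h)
        · right; rw [← Subtype.ext h, hinv]
        · left; exact σ.injective (Subtype.ext h)
      rcases key with rfl | rfl
      · rfl
      · simp only [hinv]; exact Set.pair_comm _ _
    · ext x
      simp only [Set.mem_sUnion, Set.mem_ofPred_eq]
      constructor
      · rintro ⟨d, ⟨v, rfl⟩, hx⟩
        rcases hx with rfl | hx
        · exact v.2
        · rw [Set.mem_singleton_iff] at hx
          rw [hx]; exact (σ v).2
      · intro hx
        exact ⟨_, ⟨⟨x, hx⟩, rfl⟩, by simp⟩
  · rintro ⟨σ, h1, h2⟩ ⟨τ, h3, h4⟩ h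
    simp only [Subtype.mk.injEq] at h ⊢
    have hinv : ∀ v, τ (τ v) = v := by
      intro v
      have := congrArg (fun e : Equiv.Perm R => e (τ v)) h4
      simpa using this.symm
    ext1 v
    have : ({(v : ℤ × ℤ), (σ v : ℤ × ℤ)} : Set (ℤ × ℤ)) ∈
        {d : Set (ℤ × ℤ) | ∃ v : R, d = {(v : ℤ × ℤ), (τ v : ℤ × ℤ)}} := by
      rw [← h]; exact ⟨v, rfl⟩
    obtain ⟨w, hw⟩ := this
    have hv : (v : ℤ × ℤ) ∈ ({(w : ℤ × ℤ), (τ w : ℤ × ℤ)} : Set (ℤ × ℤ)) := by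
      rw [← hw]; simp
    have hsv : (σ v : ℤ × ℤ) ∈ ({(w : ℤ × ℤ), (τ w : ℤ × ℤ)} : Set (ℤ × ℤ)) := by
      rw [← hw]; simp
    have hne : σ v ≠ v := fun h => adj_ne (h1 v) (by rw [h])
    simp only [Set.mem_insert_iff, Set.mem_singleton_iff, ← Subtype.ext_iff] at hv hsv
    rcases hv with rfl | rfl
    · rcases hsv with h | h
      · exact absurd h hne
      · exact h
    · rcases hsv with h | h
      · rw [hinv]; exact h
      · exact absurd h hne
  · rintro ⟨T, hT1, hT2, hT3⟩
    have ex : ∀ v : R, ∃ w : R, Adjacent (w : ℤ × ℤ) v ∧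
        ({(v : ℤ × ℤ), (w : ℤ × ℤ)} : Set (ℤ × ℤ)) ∈ T := by
      intro v
      have hv : (v : ℤ × ℤ) ∈ ⋃₀ T := hT3.symm ▸ v.2
      obtain ⟨d, hd, hvd⟩ := hv
      obtain ⟨a, b, hab, rfl⟩ := hT1 d hd
      have ha : a ∈ R := by rw [← hT3]; exact ⟨_, hd, by simp⟩
      have hb : b ∈ R := by rw [← hT3]; exact ⟨_, hd, by simp⟩
      rcases hvd with h | h
      · exact ⟨⟨b, hb⟩, by rw [h]; exact adj_symm hab, by rw [h]; exact hd⟩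
      · rw [Set.mem_singleton_iff] at h
        exact ⟨⟨a, ha⟩, by rw [h]; exact hab, by rw [h, Set.pair_comm]; exact hd⟩
    choose m hm1 hm2 using ex
    have uniq : ∀ d ∈ T, ∀ e ∈ T, ∀ x, x ∈ d → x ∈ e → d = e := by
      intro d hd e he x hx hx'
      by_contra hne
      exact Set.disjoint_left.1 (hT2 hd he hne) hx hx'
    have hmm : ∀ v, m (m v) = v := by
      intro v
      have h := uniq _ (hm2 v) _ (hm2 (m v)) (m v) (by simp) (by simp)
      have h2 : (m (m v) : ℤ × ℤ) ∈ ({(v : ℤ × ℤ), (m v : ℤ × ℤ)} : Set (ℤ × ℤ)) := by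
        rw [h]; simp
      rcases h2 with h2 | h2
      · exact Subtype.ext h2
      · exact absurd h2 (adj_ne (hm1 (m v)))
    refine ⟨⟨⟨m, m, hmm, hmm⟩, hm1, rfl⟩, ?_⟩
    apply Subtype.ext
    ext d
    constructor
    · rintro ⟨v, rfl⟩
      exact hm2 v
    · intro hd
      obtain ⟨a, b, hab, rfl⟩ := hT1 d hd
      have ha : a ∈ R := by rw [← hT3]; exact ⟨_, hd, by simp⟩
      exact ⟨⟨a, ha⟩, uniq _ hd _ (hm2 ⟨a, ha⟩) a (by simp) (by simp)⟩

open Classical in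
lemma odd_of_kernel (R : Set (ℤ × ℤ)) (hR : R.Finite)
    (hker : ∀ f : ℤ × ℤ → ZMod 2, (∀ q, q ∉ R → f q = 0) →
      (∀ q ∈ R, f (q.1 - 1, q.2) + f (q.1 + 1, q.2) + f (q.1, q.2 - 1) + f (q.1, q.2 + 1) = 0) →
      ∀ q, f q = 0) : Odd (numTilings R) := by
  have : Fintype R := hR.fintype
  rw [← ZMod.natCast_ne_zero_iff_odd, tiling_bij]
  rw [← det_parity (fun a b : R => Adjacent (a : ℤ × ℤ) b) (fun a b h => adj_symm h)]
  intro hdet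
  obtain ⟨w, hw0, hw⟩ := Matrix.exists_mulVec_eq_zero_iff.2 hdet
  apply hw0
  set f : ℤ × ℤ → ZMod 2 := fun q => if h : q ∈ R then w ⟨q, h⟩ else 0 with hf
  have hfw : ∀ v : R, f v = w v := by intro v; simp [hf]
  have hfz : ∀ q, q ∉ R → f q = 0 := by intro q hq; simp [hf, hq]
  have hz := hker f hfz ?_
  · funext v
    rw [← hfw, hz]; rfl
  intro q hq
  have h1 := congrFun hw ⟨q, hq⟩
  simp only [Matrix.mulVec, dotProduct, Matrix.of_apply, Pi.zero_apply, ite_mul, one_mul,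
    zero_mul] at h1
  rw [← h1]
  let φ : ℤ × ℤ → ZMod 2 := fun x => (if (q.1 - 1, q.2) = x then f x else 0) +
        (if (q.1 + 1, q.2) = x then f x else 0) + (if (q.1, q.2 - 1) = x then f x else 0) +
        (if (q.1, q.2 + 1) = x then f x else 0)
  have h2 : ∀ v : R, (if Adjacent q (v : ℤ × ℤ) then w v else 0) =
      φ (v : ℤ × ℤ) := by
    intro v
    rw [← hfw]
    simp only [φ]
    generalize f v = z
    obtain ⟨⟨a, b⟩, hv⟩ := v
    obtain ⟨c, d⟩ := q
    by_cases hA : Adjacent (c, d) (a, b)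
    · rw [if_pos hA]
      simp only [Adjacent] at hA
      simp only [Prod.mk.injEq]
      split_ifs <;> first | omega | simp
    · rw [if_neg hA]
      simp only [Adjacent] at hA
      simp only [Prod.mk.injEq]
      split_ifs <;> first | omega | simp
  rw [Finset.sum_congr rfl (fun v _ => h2 v)]
  have h3 : ∀ φ : ℤ × ℤ → ZMod 2, ∑ v : R, φ v = ∑ x ∈ hR.toFinset, φ x := by
    intro φ
    symm
    exact Finset.sum_subtype _ (by simp) φ
  refine Eq.trans ?_ (Eq.trans (h3 φ).symm ?_)
  rotate_left
  · congr!
  simp only [φ, Finset.sum_add_distrib, Finset.sum_ite_eq, Set.Finite.mem_toFinset]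
  have h4 : ∀ x, (if x ∈ R then f x else 0) = f x := by
    intro x; split_ifs with h
    · rfl
    · exact (hfz x h).symm
  simp only [h4]

/-- The d'Alembert sum. -/
def GG (g : ℤ → ZMod 2) (x : ℤ) (n : ℕ) : ZMod 2 :=
  ∑ t ∈ Finset.range n, g (x + n - 1 - 2 * t)

lemma GG_right (g : ℤ → ZMod 2) (x : ℤ) (n : ℕ) :
    GG g (x + 1) (n + 1) = GG g x n + g (x + n + 1) := by
  unfold GG
  rw [Finset.sum_range_succ']
  congr 1
  · apply Finset.sum_congr rfl
    intro t _
    congr 1; push_cast; ring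
  · congr 1; push_cast; ring

lemma GG_left (g : ℤ → ZMod 2) (x : ℤ) (n : ℕ) :
    GG g (x - 1) (n + 1) = GG g x n + g (x - n - 1) := by
  unfold GG
  rw [Finset.sum_range_succ]
  congr 1
  · apply Finset.sum_congr rfl
    intro t _
    congr 1; push_cast; ring
  · congr 1; push_cast; ring

lemma z2_cancel {a b : ZMod 2} (h : a + b = 0) : a = b := CharTwo.add_eq_zero.1 h

lemma GG_two (g : ℤ → ZMod 2) (x : ℤ) (n : ℕ) :
    GG g x (n + 2) = GG g x n + g (x - n - 1) + g (x + n + 1) := by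
  have h1 := GG_right g (x - 1) (n + 1)
  have h2 := GG_left g x n
  rw [h2] at h1
  rw [show x - 1 + 1 = x by ring] at h1
  rw [h1]; congr 2; push_cast; ring

lemma GG_rec (g : ℤ → ZMod 2) (x : ℤ) (n : ℕ) :
    GG g x (n + 2) = GG g (x - 1) (n + 1) + GG g (x + 1) (n + 1) + GG g x n := by
  rw [GG_two, GG_left, GG_right]
  generalize GG g x n = a
  generalize g (x - n - 1) = b
  generalize g (x + n + 1) = c
  revert a b c; decide

lemma GG_shift (g : ℤ → ZMod 2) (x : ℤ) (n : ℕ) :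
    GG g (x + 2) n + GG g x n = g (x + 1 + n) + g (x + 1 - n) := by
  have h1 := GG_right g x n
  have h2 := GG_left g (x + 2) n
  rw [show x + 2 - 1 = x + 1 by ring, show x + 2 - n - 1 = x + 1 - n by ring] at h2
  rw [show x + n + 1 = x + 1 + n by ring] at h1
  rw [h1] at h2
  revert h2
  generalize GG g x n = a
  generalize GG g (x + 2) n = b
  generalize g (x + 1 + n) = c
  generalize g (x + 1 - n) = d
  revert a b c d; decide

/-- The kernel statement, in reflected coordinates. -/
lemma kernel_aux (k p : ℕ) (hk : 0 < k) (hp : 0 < p) (F : ℤ → ℤ → ZMod 2)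
    (hout : ∀ x n : ℤ, ¬ (1 ≤ n ∧ n < k + p ∧ max (n - k) 0 < x ∧
      x < 2 * k + 2 * p + 1 - max (n - k) 0) → F x n = 0)
    (hharm : ∀ x n : ℤ, 1 ≤ n → n < k + p → max (n - k) 0 < x →
      x < 2 * k + 2 * p + 1 - max (n - k) 0 →
      F (x - 1) n + F (x + 1) n + F x (n - 1) + F x (n + 1) = 0) :
    ∀ x n, F x n = 0 := by
  set M : ℤ := 2 * k + 2 * p + 1 with hM
  set g : ℤ → ZMod 2 := fun y => F y 1 + F (-y) 1 + F (2 * M - y) 1 with hg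
  have hg1 : ∀ y, 0 ≤ y → y ≤ M → g y = F y 1 := by
    intro y h1 h2
    simp only [hg]
    rw [hout (-y) 1 (by omega), hout (2 * M - y) 1 (by omega)]; simp
  have hs0 : ∀ y, 0 ≤ y → y ≤ M → g (-y) = g y := by
    intro y h1 h2
    rw [hg1 y h1 h2]
    simp only [hg]
    rw [hout (-y) 1 (by omega), hout (2 * M - -y) 1 (by omega)]; simp
  have hsM : ∀ y, 0 ≤ y → y ≤ M → g (M + y) = g (M - y) := by
    intro y h1 h2
    rw [hg1 (M - y) (by omega) (by omega)]
    simp only [hg]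
    rw [hout (M + y) 1 (by omega), hout (-(M + y)) 1 (by omega)]; simp
    congr 1; ring
  have hG0 : ∀ x, GG g x 0 = 0 := by intro x; simp [GG]
  have hG1 : ∀ x, GG g x 1 = g x := by intro x; simp [GG]
  have hL : ∀ n : ℕ, n ≤ k → GG g 0 n = 0 ∧ GG g M n = 0 := by
    intro n
    induction n using Nat.twoStepInduction with
    | zero => intro _; exact ⟨hG0 _, hG0 _⟩
    | one =>
      intro _
      rw [hG1, hG1, hg1 0 (by omega) (by omega), hg1 M (by omega) (by omega)]
      exact ⟨hout _ _ (by omega), hout _ _ (by omega)⟩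
    | more n ih _ =>
      intro hn
      obtain ⟨h1, h2⟩ := ih (by omega)
      rw [GG_two, GG_two, h1, h2]
      have e1 := hs0 (n + 1) (by omega) (by omega)
      have e2 := hsM (n + 1) (by omega) (by omega)
      rw [show (0 : ℤ) - n - 1 = -(n + 1) by ring, show (0 : ℤ) + n + 1 = n + 1 by ring, e1,
        show M + n + 1 = M + (n + 1) by ring, show M - n - 1 = M - (n + 1) by ring, e2]
      simp [z2_self]
  have hag : ∀ n : ℕ, n ≤ k + p → ∀ x : ℤ, max ((n : ℤ) - k) 0 ≤ x →
      x ≤ M - max ((n : ℤ) - k) 0 → F x n = GG g x n := by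
    intro n
    induction n using Nat.twoStepInduction with
    | zero =>
      intro _ x _ _
      rw [hG0]; exact hout _ _ (by omega)
    | one =>
      intro _ x h1 h2
      rw [hG1, hg1 x (by omega) (by omega)]; rfl
    | more n ih1 ih2 =>
      intro hn x h1 h2
      push_cast at h1 h2 ih2 ⊢
      by_cases hx : max ((n : ℤ) + 1 - k) 0 < x ∧ x < M - max ((n : ℤ) + 1 - k) 0
      · have hh := hharm x (n + 1) (by omega) (by omega) hx.1 hx.2
        rw [ih2 (by omega) (x - 1) (by omega) (by omega),
          ih2 (by omega) (x + 1) (by omega) (by omega),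
          show (n : ℤ) + 1 - 1 = n by ring, ih1 (by omega) x (by omega) (by omega),
          show (n : ℤ) + 1 + 1 = n + 2 by ring] at hh
        rw [GG_rec]
        exact (z2_cancel hh).symm
      · have hnk : n + 2 ≤ k := by omega
        have hx' : x = 0 ∨ x = M := by omega
        rw [hout _ _ (by omega)]
        obtain ⟨e1, e2⟩ := hL (n + 2) hnk
        rcases hx' with rfl | rfl
        · exact e1.symm
        · exact e2.symm
  -- the diagonals
  have hd1 : ∀ s : ℕ, s ≤ p → GG g s (k + s) = 0 := by
    intro s hs
    rw [← hag (k + s) (by omega) s (by push_cast; omega) (by push_cast; omega)]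
    exact hout _ _ (by push_cast; omega)
  have hd2 : ∀ s : ℕ, s ≤ p → GG g (M - s) (k + s) = 0 := by
    intro s hs
    rw [← hag (k + s) (by omega) _ (by push_cast; omega) (by push_cast; omega)]
    exact hout _ _ (by push_cast; omega)
  have hz1 : ∀ s : ℕ, s < p → g (k + 1 + 2 * s) = 0 := by
    intro s hs
    have h := GG_right g s (k + s)
    have e1 := hd1 (s + 1) (by omega)
    push_cast at e1 h
    rw [hd1 s (by omega), show k + s + 1 = k + (s + 1) by ring, e1] at h
    rw [show (k : ℤ) + 1 + 2 * s = s + (k + s) + 1 by ring]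
    simpa using h.symm
  have hz2 : ∀ s : ℕ, s < p → g (k + 2 * p - 2 * s) = 0 := by
    intro s hs
    have h := GG_left g (M - s) (k + s)
    have e1 := hd2 (s + 1) (by omega)
    push_cast at e1 h
    rw [hd2 s (by omega), show k + s + 1 = k + (s + 1) by ring,
      show M - s - 1 = M - (s + 1) by ring, e1] at h
    rw [show (k : ℤ) + 2 * p - 2 * s = M - s - (k + s) - 1 by rw [hM]; ring]
    simpa using h.symm
  have hmid : ∀ y : ℤ, k + 1 ≤ y → y ≤ k + 2 * p → g y = 0 := by
    intro y h1 h2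
    rcases Int.even_or_odd' (y - k) with ⟨c, hc | hc⟩
    · have := hz2 (p - c).toNat (by omega)
      rw [show (k : ℤ) + 2 * p - 2 * ((p - c).toNat : ℕ) = y by omega] at this
      exact this
    · have := hz1 c.toNat (by omega)
      rw [show (k : ℤ) + 1 + 2 * (c.toNat : ℕ) = y by omega] at this
      exact this
  -- the top wall
  have htop : ∀ x : ℤ, p ≤ x → x ≤ M - p → GG g x (k + p) = 0 := by
    intro x h1 h2
    rw [← hag (k + p) le_rfl x (by push_cast; omega) (by push_cast; omega)]
    exact hout _ _ (by push_cast; omega)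
  have hrel : ∀ u : ℤ, -k ≤ u → u ≤ k - 1 → g (M + u) = g (u + 1) := by
    intro u h1 h2
    have h := GG_shift g (p + k + u) (k + p)
    rw [htop _ (by omega) (by omega), htop _ (by omega) (by omega)] at h
    push_cast at h
    rw [show (p : ℤ) + k + u + 1 + (k + p) = M + u by rw [hM]; ring,
      show (p : ℤ) + k + u + 1 - (k + p) = u + 1 by ring] at h
    exact z2_cancel (by rw [← h]; simp)
  have hend : ∀ y : ℕ, y ≤ k → g y = 0 ∧ g (M - y) = 0 := by
    intro y
    induction y with
    | zero =>
      intro _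
      push_cast
      rw [hg1 0 (by omega) (by omega), hg1 (M - 0) (by omega) (by omega)]
      exact ⟨hout _ _ (by omega), hout _ _ (by omega)⟩
    | succ y ih =>
      intro hy
      obtain ⟨h1, h2⟩ := ih (by omega)
      push_cast
      constructor
      · rw [← hrel y (by omega) (by omega), hsM y (by omega) (by omega)]; exact h2
      · rw [show M - ((y : ℤ) + 1) = M + (-y - 1) by ring, hrel _ (by omega) (by omega),
          show -(y : ℤ) - 1 + 1 = -y by ring, hs0 y (by omega) (by omega)]
        exact h1
  have hgz : ∀ y : ℤ, 0 ≤ y → y ≤ M → g y = 0 := by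
    intro y h1 h2
    by_cases c1 : y ≤ k
    · have := (hend y.toNat (by omega)).1
      rwa [show ((y.toNat : ℕ) : ℤ) = y by omega] at this
    by_cases c2 : y ≤ k + 2 * p
    · exact hmid y (by omega) c2
    · have := (hend (M - y).toNat (by omega)).2
      rwa [show M - (((M - y).toNat : ℕ) : ℤ) = y by omega] at this
  have hF1 : ∀ y, F y 1 = 0 := by
    intro y
    by_cases h : 0 ≤ y ∧ y ≤ M
    · rw [← hg1 y h.1 h.2]; exact hgz y h.1 h.2
    · exact hout _ _ (by omega)
  intro x n
  by_cases h : 1 ≤ n ∧ n < k + p ∧ max (n - k) 0 < x ∧ x < M - max (n - k) 0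
  · have := hag n.toNat (by omega) x (by omega) (by omega)
    rw [show ((n.toNat : ℕ) : ℤ) = n by omega] at this
    rw [this]
    simp [GG, hg, hF1]
  · exact hout _ _ h

end Helpers

theorem T_k_2k2_odd (k p : ℕ) (hk : 0 < k) (hp : 0 < p) :
    Odd (numTilings (Treg k (2 * k + 2) p)) := by
  apply odd_of_kernel
  · apply Set.Finite.subset (Set.finite_Icc ((0 : ℤ), (0 : ℤ)) ((2 * k + 2 * p : ℤ), (k + p : ℤ)))
    rintro ⟨c, r⟩ h
    simp only [Treg, Set.mem_ofPred_eq] at h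
    push_cast at h
    simp only [Set.mem_Icc, Prod.mk_le_mk]
    omega
  · intro f h1 h2
    have := kernel_aux k p hk hp (fun x n => f (x - 1, k + p - 1 - n)) ?_ ?_
    · rintro ⟨c, r⟩
      have h := this (c + 1) (k + p - 1 - r)
      simpa using h
    · intro x n h
      apply h1
      simp only [Treg, Set.mem_ofPred_eq]
      push_cast
      omega
    · intro x n a1 a2 a3 a4
      have h := h2 (x - 1, k + p - 1 - n) (by
        simp only [Treg, Set.mem_ofPred_eq]
        push_cast
        omega)
      simp only at h ⊢
      rw [show x + 1 - 1 = x - 1 + 1 by ring,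
        show (k : ℤ) + p - 1 - (n - 1) = k + p - 1 - n + 1 by ring,
        show (k : ℤ) + p - 1 - (n + 1) = k + p - 1 - n - 1 by ring]
      rw [← h]; ring
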